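/- Let E be a finite-dimensional real inner product space, let 0 < γ ≤ G, and let L : E → ℝ be differentiable with G-Lipschitz gradient ∇L and γ-strongly convex, i.e. the function θ ↦ L(θ) − (γ/2)‖θ‖² is convex. Let θ* be the global minimizer of L and let 0 < η ≤ 1/G. Then for every θ ∈ E and every g ∈ E, ‖(θ − η g) − θ*‖ ≤ (1 − η γ / 2) ‖θ − θ*‖ + η ‖∇L(θ) − g‖. -/

import Mathlib

open scoped RealInnerProductSpace

section

variable {E : Type*} [NormedAddCommGroup E] [InnerProductSpace ℝ E] [CompleteSpace E]
  {f : E → ℝ} {x f' : E}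

/-- Derivative along a line of a function with a gradient. -/
theorem HasGradientAt.hasDerivAt_add_smul {v : E} {t : ℝ} (h : HasGradientAt f f' (x + t • v)) :
    HasDerivAt (fun s : ℝ => f (x + s • v)) ⟪f', v⟫ t := by
  have hline : HasDerivAt (fun s : ℝ => x + s • v) v t := by
    simpa using ((hasDerivAt_id t).smul_const v).const_add x
  simpa [Function.comp_def] using h.hasFDerivAt.comp_hasDerivAt t hline

/-- First-order lower bound for a convex function. -/
theorem ConvexOn.add_inner_le_of_hasGradientAt (hf : ConvexOn ℝ Set.univ f)
    (h : HasGradientAt f f' x) (y : E) : f x + ⟪f', y - x⟫ ≤ f y := by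
  have hline : ConvexOn ℝ Set.univ (fun s : ℝ => f (x + s • (y - x))) := by
    have := hf.comp_affineMap (AffineMap.lineMap x y : ℝ →ᵃ[ℝ] E)
    simpa [Function.comp_def, AffineMap.lineMap_apply, add_comm] using this
  have hd : HasDerivAt (fun s : ℝ => f (x + s • (y - x))) ⟪f', y - x⟫ 0 :=
    HasGradientAt.hasDerivAt_add_smul (by simpa using h)
  have := hline.le_slope_of_hasDerivAt (Set.mem_univ 0) (Set.mem_univ 1) zero_lt_one hd
  simp [slope_def_field] at this
  linarith

/-- First-order quadratic lower bound for a strongly convex function. -/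
theorem ConvexOn.add_inner_add_sq_le_of_hasGradientAt {γ : ℝ}
    (hf : ConvexOn ℝ Set.univ (fun z => f z - γ / 2 * ‖z‖ ^ 2))
    (h : HasGradientAt f f' x) (y : E) :
    f x + ⟪f', y - x⟫ + γ / 2 * ‖y - x‖ ^ 2 ≤ f y := by
  have hgrad : HasGradientAt (fun z => f z - γ / 2 * ‖z‖ ^ 2) (f' - γ • x) x := by
    rw [hasGradientAt_iff_hasFDerivAt] at h ⊢
    refine (h.sub ((hasStrictFDerivAt_norm_sq x).hasFDerivAt.const_mul (γ / 2))).congr_fderiv ?_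
    ext w
    simp
    ring
  have := hf.add_inner_le_of_hasGradientAt hgrad y
  rw [inner_sub_left, real_inner_smul_left, inner_sub_right x, real_inner_self_eq_norm_sq] at this
  rw [norm_sub_sq_real, real_inner_comm x y]
  linarith

/-- The descent lemma: quadratic upper bound for a function with Lipschitz gradient. -/
theorem le_add_inner_add_sq_of_lipschitz_gradient {g : E → E} {G : ℝ}
    (hgrad : ∀ z, HasGradientAt f (g z) z) (hlip : ∀ z w, ‖g z - g w‖ ≤ G * ‖z - w‖) (x v : E) :
    f (x + v) ≤ f x + ⟪g x, v⟫ + G / 2 * ‖v‖ ^ 2 := by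
  have hd (t : ℝ) : HasDerivAt
      (fun s : ℝ => f (x + s • v) - s * ⟪g x, v⟫ - s ^ 2 * (G / 2 * ‖v‖ ^ 2))
      (⟪g (x + t • v), v⟫ - ⟪g x, v⟫ - t * (G * ‖v‖ ^ 2)) t := by
    refine (((hgrad _).hasDerivAt_add_smul.sub ((hasDerivAt_id t).mul_const _)).sub
      ((hasDerivAt_pow 2 t).mul_const _)).congr_deriv ?_
    simp
    ring
  have hanti := antitoneOn_of_deriv_nonpos (convex_Ici (0 : ℝ))
    (fun t _ => (hd t).continuousAt.continuousWithinAt)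
    (fun t _ => (hd t).differentiableAt.differentiableWithinAt)
    (fun t ht => by
      rw [interior_Ici, Set.mem_Ioi] at ht
      rw [(hd t).deriv, ← inner_sub_left]
      have h := hlip (x + t • v) x
      rw [add_sub_cancel_left, norm_smul, Real.norm_of_nonneg ht.le] at h
      nlinarith [real_inner_le_norm (g (x + t • v) - g x) v, norm_nonneg v])
  have := hanti Set.self_mem_Ici (Set.mem_Ici.2 zero_le_one) zero_le_one
  simp at this
  linarith

/-- One exact gradient step with step size at most `1 / G` contracts the distance to a
minimizer. -/
theorem norm_gradient_step_sub_le {g : E → E} {γ G η : ℝ} (hG : 0 < G) (hγG : γ ≤ G)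
    (hgrad : ∀ z, HasGradientAt f (g z) z) (hlip : ∀ z w, ‖g z - g w‖ ≤ G * ‖z - w‖)
    (hconv : ConvexOn ℝ Set.univ (fun z => f z - γ / 2 * ‖z‖ ^ 2))
    {y : E} (hmin : ∀ z, f y ≤ f z) (hη0 : 0 < η) (hη : η ≤ 1 / G) (x : E) :
    ‖(x - η • g x) - y‖ ≤ (1 - η * γ / 2) * ‖x - y‖ := by
  have hηG : η * G ≤ 1 := (le_div_iff₀ hG).1 hη
  have hηγ : η * γ ≤ 1 := (mul_le_mul_of_nonneg_left hγG hη0.le).trans hηG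
  have hlower := hconv.add_inner_add_sq_le_of_hasGradientAt (hgrad x) y
  have hupper := le_add_inner_add_sq_of_lipschitz_gradient hgrad hlip x (-(η • g x))
  have hy := hmin (x + -(η • g x))
  rw [inner_neg_right, real_inner_smul_right, real_inner_self_eq_norm_sq, norm_neg, norm_smul,
    Real.norm_of_nonneg hη0.le] at hupper
  rw [← neg_sub x y, inner_neg_right, norm_neg] at hlower
  have hdescent : η * ‖g x‖ ^ 2 ≤ 2 * (f x - f y) := by
    nlinarith [mul_le_mul_of_nonneg_right hηG (mul_nonneg hη0.le (sq_nonneg ‖g x‖))]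
  refine (sq_le_sq₀ (norm_nonneg _) (mul_nonneg (by linarith) (norm_nonneg _))).1 ?_
  have hexpand : ‖(x - η • g x) - y‖ ^ 2
      = ‖x - y‖ ^ 2 - 2 * η * ⟪g x, x - y⟫ + η * (η * ‖g x‖ ^ 2) := by
    rw [sub_right_comm, norm_sub_sq_real, real_inner_smul_right, real_inner_comm, norm_smul,
      Real.norm_of_nonneg hη0.le]
    ring
  rw [hexpand]
  nlinarith [mul_le_mul_of_nonneg_left hdescent hη0.le, mul_le_mul_of_nonneg_left hlower hη0.le,
    sq_nonneg (η * γ / 2 * ‖x - y‖)]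

end

/-- Let `E` be a finite-dimensional real inner product space, `0 < γ ≤ G`, and let
`L : E → ℝ` be differentiable with `G`-Lipschitz gradient `g` and `γ`-strongly convex
(i.e. `θ ↦ L θ − (γ/2)‖θ‖²` is convex). Let `θ*` be the global minimizer of `L` and
`0 < η ≤ 1/G`. Then for every `θ` and every `v ∈ E`,
`‖(θ − η v) − θ*‖ ≤ (1 − η γ / 2) ‖θ − θ*‖ + η ‖∇L(θ) − v‖`. -/
theorem noisy_gradient_step_bound {E : Type*} [NormedAddCommGroup E]
    [InnerProductSpace ℝ E] [FiniteDimensional ℝ E]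
    (γ G : ℝ) (hγ : 0 < γ) (hγG : γ ≤ G)
    (L : E → ℝ) (g : E → E)
    (hgrad : ∀ θ, HasGradientAt L (g θ) θ)
    (hlip : ∀ θ θ' : E, ‖g θ - g θ'‖ ≤ G * ‖θ - θ'‖)
    (hconv : ConvexOn ℝ Set.univ (fun θ => L θ - γ / 2 * ‖θ‖ ^ 2))
    (θstar : E) (hmin : ∀ θ, L θstar ≤ L θ)
    (η : ℝ) (hη0 : 0 < η) (hη : η ≤ 1 / G) (θ v : E) :
    ‖(θ - η • v) - θstar‖ ≤ (1 - η * γ / 2) * ‖θ - θstar‖ + η * ‖g θ - v‖ := by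
  have hstep := norm_gradient_step_sub_le (hγ.trans_le hγG) hγG hgrad hlip hconv hmin hη0 hη θ
  calc ‖(θ - η • v) - θstar‖ = ‖((θ - η • g θ) - θstar) + η • (g θ - v)‖ := by
        congr 1
        rw [smul_sub]
        abel
    _ ≤ ‖(θ - η • g θ) - θstar‖ + ‖η • (g θ - v)‖ := norm_add_le _ _
    _ ≤ _ := by
        rw [norm_smul, Real.norm_of_nonneg hη0.le]
        gcongr
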